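/- With the channel setup below, the following determinant inequality holds: det(I_{N1} + (ρ11/M1)·H11·H11† + ρ21·H21·K2u·H21†) ≥ det(I_{N1} + ρ11·H11·H11†) · det(I_{N1} + ρ21·H21·K2u·H21†) / ( M1^{min(M1,N1)} · ((M2+1)/M2)^{min(M2,N1)} ), where all determinants are positive real numbers. -/

import Mathlib

open Matrix ComplexOrder

/-- `KK H ρ = (I + ρ·H†·H)⁻¹`. -/
noncomputable def KK {m n : ℕ} (H : Matrix (Fin n) (Fin m) ℂ) (ρ : ℝ) :
    Matrix (Fin m) (Fin m) ℂ :=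
  (1 + (ρ : ℂ) • (Hᴴ * H))⁻¹

/-- `Ku H ρ = (1/m)·(I + ρ·H†·H)⁻¹` where `m` is the column dimension. -/
noncomputable def Ku {m n : ℕ} (H : Matrix (Fin n) (Fin m) ℂ) (ρ : ℝ) :
    Matrix (Fin m) (Fin m) ℂ :=
  ((m : ℂ))⁻¹ • KK H ρ

section LoewnerDeterminant

variable {n : Type*} [DecidableEq n]

theorem posDef_one_add {A : Matrix n n ℂ} (hA : A.PosSemidef) : (1 + A).PosDef :=
  PosDef.one.add_posSemidef hA

variable [Fintype n]

theorem one_le_det_one_add {A : Matrix n n ℂ} (hA : A.PosSemidef) : 1 ≤ (1 + A).det := by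
  have hd : (1 + A).det = ∏ i, (1 + (hA.1.eigenvalues i : ℂ)) := by
    conv_lhs => rw [hA.1.spectral_theorem]
    rw [Unitary.conjStarAlgAut_apply, mul_assoc, det_one_add_mul_comm, mul_assoc,
      Unitary.coe_star_mul_self, mul_one, ← diagonal_one, diagonal_add, det_diagonal]
    rfl
  rw [hd]
  have : (1 : ℝ) ≤ ∏ i, (1 + hA.1.eigenvalues i) :=
    Finset.one_le_prod fun i => by simpa using hA.eigenvalues_nonneg i
  exact_mod_cast this

open scoped MatrixOrder Matrix.Norms.L2Operator in
theorem det_le_det_add {P A : Matrix n n ℂ} (hP : P.PosDef) (hA : A.PosSemidef) :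
    P.det ≤ (P + A).det := by
  obtain ⟨B, rfl⟩ := CStarAlgebra.nonneg_iff_eq_star_mul_self.mp hA.nonneg
  have h := one_le_det_one_add (hP.posSemidef.inv.mul_mul_conjTranspose_same B)
  rw [star_eq_conjTranspose, det_add_mul _ _ (P.isUnit_iff_isUnit_det.mp hP.isUnit)]
  exact le_mul_of_one_le_right hP.det_pos.le h

theorem det_one_add_le_pow_mul {A : Matrix n n ℂ} (hA : A.PosSemidef) {c : ℂ} (hc : 1 ≤ c) :
    (1 + A).det ≤ c ^ Fintype.card n * (1 + c⁻¹ • A).det := by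
  have hc0 : c ≠ 0 := (zero_lt_one.trans_le hc).ne'
  rw [← det_smul]
  convert det_le_det_add (posDef_one_add hA) (PosSemidef.one.smul (sub_nonneg.2 hc)) using 2
  rw [smul_add, smul_inv_smul₀ hc0, sub_smul, one_smul]
  abel

theorem det_one_add_smul_le_pow {A : Matrix n n ℂ} (hA : A.PosSemidef)
    (hA' : (1 - A).PosSemidef) {t : ℂ} (ht : 0 ≤ t) :
    (1 + t • A).det ≤ (1 + t) ^ Fintype.card n := by
  convert det_le_det_add (posDef_one_add (hA.smul ht)) (hA'.smul ht) using 1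
  rw [smul_sub, add_add_sub_cancel, ← one_smul ℂ (1 : Matrix n n ℂ), smul_smul, mul_one,
    ← add_smul, det_smul, det_one, mul_one]

end LoewnerDeterminant

section Channel

variable {m n : ℕ} (H : Matrix (Fin n) (Fin m) ℂ) {ρ : ℝ}

theorem det_one_add_smul_mul_conjTranspose_comm (s : ℂ) :
    (1 + s • (H * Hᴴ)).det = (1 + s • (Hᴴ * H)).det := by
  rw [← smul_mul, det_one_add_mul_comm, Matrix.mul_smul]

theorem det_one_add_smul_mul_conjTranspose_le (hρ : 0 ≤ ρ) {c : ℂ} (hc : 1 ≤ c) :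
    (1 + (ρ : ℂ) • (H * Hᴴ)).det
      ≤ c ^ min m n * (1 + (c⁻¹ * ρ) • (H * Hᴴ)).det := by
  have hρ' : (0 : ℂ) ≤ ρ := by exact_mod_cast hρ
  rcases le_total m n with h | h
  · rw [min_eq_left h, det_one_add_smul_mul_conjTranspose_comm,
      det_one_add_smul_mul_conjTranspose_comm]
    simpa only [smul_smul, Fintype.card_fin] using
      det_one_add_le_pow_mul ((posSemidef_conjTranspose_mul_self H).smul hρ') hc
  · rw [min_eq_right h]
    simpa only [smul_smul, Fintype.card_fin] using
      det_one_add_le_pow_mul ((posSemidef_self_mul_conjTranspose H).smul hρ') hc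

theorem posDef_one_add_smul_conjTranspose_mul_self (hρ : 0 ≤ ρ) :
    (1 + (ρ : ℂ) • (Hᴴ * H)).PosDef :=
  posDef_one_add ((posSemidef_conjTranspose_mul_self H).smul (by exact_mod_cast hρ))

theorem posDef_KK (hρ : 0 ≤ ρ) : (KK H ρ).PosDef :=
  (posDef_one_add_smul_conjTranspose_mul_self H hρ).inv

theorem KK_mul_cancel (hρ : 0 ≤ ρ) : KK H ρ * (1 + (ρ : ℂ) • (Hᴴ * H)) = 1 :=
  nonsing_inv_mul _ ((isUnit_iff_isUnit_det _).1
    (posDef_one_add_smul_conjTranspose_mul_self H hρ).isUnit)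

theorem mul_KK_cancel (hρ : 0 ≤ ρ) : (1 + (ρ : ℂ) • (Hᴴ * H)) * KK H ρ = 1 :=
  mul_eq_one_comm.1 (KK_mul_cancel H hρ)

theorem KK_mul_conjTranspose (hρ : 0 ≤ ρ) : KK H ρ * Hᴴ = Hᴴ * KK Hᴴ ρ := by
  have h : Hᴴ * (1 + (ρ : ℂ) • (Hᴴᴴ * Hᴴ)) = (1 + (ρ : ℂ) • (Hᴴ * H)) * Hᴴ := by
    simp [Matrix.mul_add, Matrix.add_mul, Matrix.mul_assoc]
  calc KK H ρ * Hᴴ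
      = KK H ρ * (Hᴴ * (1 + (ρ : ℂ) • (Hᴴᴴ * Hᴴ))) * KK Hᴴ ρ := by
        rw [Matrix.mul_assoc, Matrix.mul_assoc, mul_KK_cancel Hᴴ hρ, Matrix.mul_one]
    _ = Hᴴ * KK Hᴴ ρ := by
        rw [h, ← Matrix.mul_assoc, KK_mul_cancel H hρ, Matrix.one_mul]

theorem posSemidef_smul_mul_KK_mul (hρ : 0 ≤ ρ) :
    ((ρ : ℂ) • (H * KK H ρ * Hᴴ)).PosSemidef :=
  ((posDef_KK H hρ).posSemidef.mul_mul_conjTranspose_same H).smul (by exact_mod_cast hρ)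

theorem one_sub_smul_mul_KK_mul (hρ : 0 ≤ ρ) :
    1 - (ρ : ℂ) • (H * KK H ρ * Hᴴ) = KK Hᴴ ρ := by
  have h := mul_KK_cancel Hᴴ hρ
  rw [Matrix.add_mul, Matrix.one_mul, conjTranspose_conjTranspose, smul_mul,
    Matrix.mul_assoc, ← KK_mul_conjTranspose H hρ, ← Matrix.mul_assoc] at h
  rw [← h, add_sub_cancel_right]

theorem det_one_add_smul_mul_KK_mul_comm (hρ : 0 ≤ ρ) (t : ℂ) :
    (1 + t • (ρ : ℂ) • (H * KK H ρ * Hᴴ)).det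
      = (1 + t • (ρ : ℂ) • (Hᴴ * KK Hᴴ ρ * Hᴴᴴ)).det := by
  rw [Matrix.mul_assoc, ← Matrix.mul_smul, ← Matrix.mul_smul, det_one_add_mul_comm,
    KK_mul_conjTranspose H hρ, smul_mul, smul_mul, conjTranspose_conjTranspose]

theorem det_one_add_smul_mul_KK_mul_le (hρ : 0 ≤ ρ) {t : ℂ} (ht : 0 ≤ t) :
    (1 + t • (ρ : ℂ) • (H * KK H ρ * Hᴴ)).det ≤ (1 + t) ^ min m n := by
  have aux {m n : ℕ} (G : Matrix (Fin n) (Fin m) ℂ) :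
      (1 + t • (ρ : ℂ) • (G * KK G ρ * Gᴴ)).det ≤ (1 + t) ^ n := by
    simpa using det_one_add_smul_le_pow (posSemidef_smul_mul_KK_mul G hρ)
      (one_sub_smul_mul_KK_mul G hρ ▸ (posDef_KK Gᴴ hρ).posSemidef) ht
  rcases le_total m n with h | h
  · rw [min_eq_left h, det_one_add_smul_mul_KK_mul_comm H hρ]
    exact aux Hᴴ
  · rw [min_eq_right h]
    exact aux H

theorem smul_mul_Ku_mul :
    (ρ : ℂ) • (H * Ku H ρ * Hᴴ) = (m : ℂ)⁻¹ • (ρ : ℂ) • (H * KK H ρ * Hᴴ) := by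
  rw [Ku, Matrix.mul_smul, smul_mul, smul_comm]

end Channel


/-- With `K2u = (1/M2)·(I_{M2}+ρ21·H21†H21)⁻¹`:
`det(I + (ρ11/M1)·H11·H11† + ρ21·H21·K2u·H21†) ≥
 det(I + ρ11·H11·H11†)·det(I + ρ21·H21·K2u·H21†) / (M1^{min(M1,N1)}·((M2+1)/M2)^{min(M2,N1)})`. -/
theorem stmt_10 (M1 M2 N1 N2 : ℕ) (hM1 : 0 < M1) (hM2 : 0 < M2) (hN1 : 0 < N1) (hN2 : 0 < N2)
    (H11 : Matrix (Fin N1) (Fin M1) ℂ) (H21 : Matrix (Fin N1) (Fin M2) ℂ)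
    (H12 : Matrix (Fin N2) (Fin M1) ℂ) (H22 : Matrix (Fin N2) (Fin M2) ℂ)
    (ρ11 ρ12 ρ21 ρ22 : ℝ) (h11 : 0 ≤ ρ11) (h12 : 0 ≤ ρ12) (h21 : 0 ≤ ρ21) (h22 : 0 ≤ ρ22) :
    ((1 + (ρ11 : ℂ) • (H11 * H11ᴴ)).det).re
        * ((1 + (ρ21 : ℂ) • (H21 * Ku H21 ρ21 * H21ᴴ)).det).re
        / ((M1 : ℝ) ^ (min M1 N1) * (((M2 : ℝ) + 1) / M2) ^ (min M2 N1))
      ≤ ((1 + ((ρ11 / M1 : ℝ) : ℂ) • (H11 * H11ᴴ)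
          + (ρ21 : ℂ) • (H21 * Ku H21 ρ21 * H21ᴴ)).det).re := by
  have hM1' : (1 : ℂ) ≤ M1 := by exact_mod_cast hM1
  have ht : (0 : ℂ) ≤ (M2 : ℂ)⁻¹ := inv_nonneg.2 (Nat.cast_nonneg M2)
  have hρ : (0 : ℂ) ≤ ((ρ11 / M1 : ℝ) : ℂ) := by
    exact_mod_cast div_nonneg h11 (Nat.cast_nonneg M1)
  have hs : ((ρ11 / M1 : ℝ) : ℂ) = (M1 : ℂ)⁻¹ * ρ11 := by push_cast; ring
  have hd : ((M2 : ℝ) + 1) / M2 = 1 + (M2 : ℝ)⁻¹ := by field_simp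
  have hA := posDef_one_add ((posSemidef_self_mul_conjTranspose H11).smul hρ)
  have hB := (posSemidef_smul_mul_KK_mul H21 h21).smul ht
  have h₁ := det_one_add_smul_mul_conjTranspose_le H11 h11 hM1'
  have h₂ := det_one_add_smul_mul_KK_mul_le H21 h21 ht
  have h₃ := det_le_det_add hA hB
  have hB0 := (posDef_one_add hB).det_pos.le
  have hA0 := hA.det_pos.le
  rw [← hs] at h₁
  rw [smul_mul_Ku_mul, hd]
  have h₁' := (Complex.le_def.1 h₁).1
  have h₂' := (Complex.le_def.1 h₂).1
  have e₁ : (M1 : ℂ) ^ min M1 N1 = (((M1 : ℝ) ^ min M1 N1 : ℝ) : ℂ) := by push_cast; rfl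
  have e₂ : (1 + (M2 : ℂ)⁻¹) ^ min M2 N1
      = (((1 + (M2 : ℝ)⁻¹) ^ min M2 N1 : ℝ) : ℂ) := by push_cast; rfl
  rw [e₁, Complex.re_ofReal_mul] at h₁'
  rw [e₂, Complex.ofReal_re] at h₂'
  refine div_le_of_le_mul₀ (by positivity) ((Complex.le_def.1 (hA0.trans h₃)).1) ?_
  calc _ ≤ (M1 : ℝ) ^ min M1 N1 * (1 + ((ρ11 / M1 : ℝ) : ℂ) • (H11 * H11ᴴ)).det.re
          * (1 + (M2 : ℝ)⁻¹) ^ min M2 N1 :=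
        mul_le_mul h₁' h₂' (Complex.le_def.1 hB0).1
          (mul_nonneg (by positivity) (Complex.le_def.1 hA0).1)
    _ = (1 + ((ρ11 / M1 : ℝ) : ℂ) • (H11 * H11ᴴ)).det.re
          * ((M1 : ℝ) ^ min M1 N1 * (1 + (M2 : ℝ)⁻¹) ^ min M2 N1) := by ring
    _ ≤ _ := mul_le_mul_of_nonneg_right (Complex.le_def.1 h₃).1 (by positivity)
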